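/- For every number of players p ∈ {2, 3, 4, 5}, every trace of the p-player Hanabi bookkeeping model has length at most 7 + 2·d₀ + p; explicitly, at most 89 for p = 2, at most 80 for p = 3, at most 79 for p = 4, and at most 72 for p = 5. -/

import Mathlib

/-- A state of the Hanabi bookkeeping model:
`m` hint tokens, `d` cards left in the deck, `q` remaining turns once the
deck is empty, `f` completed fireworks, `s` score. -/
structure HState where
  m : ℕ
  d : ℕ
  q : ℕ
  f : ℕ
  s : ℕ

/-- The invariants a state must satisfy. -/
def HState.valid (st : HState) : Prop :=
  st.m ≤ 8 ∧ st.f ≤ 5 ∧ 5 * st.f ≤ st.s ∧ st.s ≤ 20 + st.f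

/-- The possible kinds of turns. -/
inductive HAction where
  | hint | discard | playFail | playSucc | playComplete
deriving DecidableEq

/-- Is the action a play (successful or not, possibly firework-completing)? -/
def HAction.isPlay : HAction → Prop
  | .hint => False
  | .discard => False
  | _ => True

instance : DecidablePred HAction.isPlay := by
  intro a; cases a <;> simp [HAction.isPlay] <;> infer_instance

/-- A turn of kind `a` from state `st` to state `st'`. -/
def Step (a : HAction) (st st' : HState) : Prop :=
  st.valid ∧ st'.valid ∧
  -- a turn is allowed only if the score is below 25 and the game is not over
  st.s < 25 ∧ (1 ≤ st.d ∨ 1 ≤ st.q) ∧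
  -- update of the deck size and of the remaining-turns counter
  st'.d = (if 1 ≤ st.d ∧ a ≠ .hint then st.d - 1 else st.d) ∧
  st'.q = (if st.d = 0 then st.q - 1 else st.q) ∧
  -- effect of the individual actions
  (match a with
  | .hint => 1 ≤ st.m ∧ st'.m = st.m - 1 ∧ st'.f = st.f ∧ st'.s = st.s
  | .discard => st.m ≤ 7 ∧ st'.m = st.m + 1 ∧ st'.f = st.f ∧ st'.s = st.s
  | .playFail => st'.m = st.m ∧ st'.f = st.f ∧ st'.s = st.s
  | .playSucc => st'.m = st.m ∧ st'.f = st.f ∧ st'.s = st.s + 1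
  | .playComplete =>
      st.f ≤ 4 ∧ st'.m = min (st.m + 1) 8 ∧ st'.f = st.f + 1 ∧ st'.s = st.s + 1)

/-- Hand size for `p` players. -/
def handSize (p : ℕ) : ℕ := if p ≤ 3 then 5 else 4

/-- Initial deck size for `p` players. -/
def initialDeck (p : ℕ) : ℕ := 50 - p * handSize p

/-- The initial state for `p` players. -/
def initState (p : ℕ) : HState := ⟨8, initialDeck p, p, 0, 0⟩

/-- A trace of length `n` (i.e. with `n` turns) of the `p`-player Hanabi
bookkeeping model: `n + 1` states starting at the initial state, with
consecutive states related by turns. -/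
structure Trace (p n : ℕ) where
  state : Fin (n + 1) → HState
  action : Fin n → HAction
  init : state 0 = initState p
  step : ∀ t : Fin n, Step (action t) (state t.castSucc) (state t.succ)

/-- An upper bound for the number of turns that can still be made from `st`. -/
def HState.turnBound (st : HState) : ℕ :=
  if st.d = 0 then st.q else st.m + 2 * st.d - 1 + st.q

theorem Step.turnBound_lt {a : HAction} {st st' : HState} (h : Step a st st') :
    st'.turnBound < st.turnBound := by
  obtain ⟨-, -, -, hlive, hd, hq, hact⟩ := h
  unfold HState.turnBound
  cases a <;> simp only [ne_eq, reduceCtorEq, not_true_eq_false, not_false_eq_true,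
    and_true, and_false, if_false] at hd hact <;> grind

theorem Trace.add_turnBound_le {p n : ℕ} (tr : Trace p n) (t : Fin (n + 1)) :
    (t : ℕ) + (tr.state t).turnBound ≤ (initState p).turnBound := by
  induction t using Fin.induction with
  | zero => simp [tr.init]
  | succ t ih =>
    have hlt := (tr.step t).turnBound_lt
    rw [Fin.val_castSucc] at ih
    rw [Fin.val_succ]
    omega

theorem turnBound_initState {p : ℕ} (hp : p ≤ 5) :
    (initState p).turnBound = 7 + 2 * initialDeck p + p := by
  interval_cases p <;> rfl

/-- For every number of players `p ∈ {2, 3, 4, 5}`, every trace of the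
`p`-player Hanabi bookkeeping model has length at most `7 + 2 * d₀ + p`;
explicitly, at most 89, 80, 79, 72 for `p = 2, 3, 4, 5` respectively. -/
theorem hanabi_max_length (p : ℕ) (hp₂ : 2 ≤ p) (hp₅ : p ≤ 5)
    (n : ℕ) (tr : Trace p n) :
    n ≤ 7 + 2 * initialDeck p + p ∧
    (p = 2 → n ≤ 89) ∧ (p = 3 → n ≤ 80) ∧ (p = 4 → n ≤ 79) ∧
    (p = 5 → n ≤ 72) := by
  have hn : n ≤ 7 + 2 * initialDeck p + p := by
    have hlast := tr.add_turnBound_le (Fin.last n)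
    rw [Fin.val_last, turnBound_initState hp₅] at hlast
    omega
  refine ⟨hn, ?_, ?_, ?_, ?_⟩ <;> rintro rfl <;> exact hn
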